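/- For every σ ∈ ℝ with |σ| ≤ m for m = ⌈|σ|⌉, ∫_0^∞ ∫_1^∞ H(y) R(xy) x^{σ−1} y^{2σ−1} dx dy ≤ C_{m+1} ∫_0^∞ y^{2(σ−1)−m} H(y) dy, where H(y) = y² G''(y) + 2y G'(y), G = 1 + R, R(y) = 2∑_{n=1}^∞ e^{-π n² y²}, and C_n = sup_{y>0} yⁿ R(y). -/

import Mathlib

open Real Set MeasureTheory

noncomputable def Rf (y : ℝ) : ℝ := 2 * ∑' n : ℕ, Real.exp (-π * (n + 1) ^ 2 * y ^ 2)

noncomputable def Gf (y : ℝ) : ℝ := 1 + Rf y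

noncomputable def Hf (y : ℝ) : ℝ := y ^ 2 * deriv (deriv Gf) y + 2 * y * deriv Gf y

noncomputable def Cn (n : ℕ) : ℝ := sSup {x : ℝ | ∃ y : ℝ, 0 < y ∧ x = y ^ n * Rf y}

noncomputable def Sx (k : ℕ) (y : ℝ) : ℝ :=
  ∑' n : ℕ, ((n : ℝ) + 1) ^ k * Real.exp (-π * (n + 1) ^ 2 * y ^ 2)

lemma sx_summable_c (k : ℕ) {c : ℝ} (hc : 0 < c) :
    Summable fun n : ℕ => ((n : ℝ) + 1) ^ k * Real.exp (-(c * (n + 1) ^ 2)) := by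
  have h := (summable_nat_add_iff 1).2 (Real.summable_pow_mul_exp_neg_nat_mul k hc)
  refine Summable.of_nonneg_of_le (fun n => by positivity) (fun n => ?_) h
  push_cast
  gcongr
  have hn : (0 : ℝ) ≤ n := Nat.cast_nonneg n
  have : (n : ℝ) + 1 ≤ (n + 1) ^ 2 := by nlinarith
  nlinarith

lemma sx_summable (k : ℕ) {y : ℝ} (hy : 0 < y) :
    Summable fun n : ℕ => ((n : ℝ) + 1) ^ k * Real.exp (-π * (n + 1) ^ 2 * y ^ 2) := by
  have h := sx_summable_c k (c := π * y ^ 2) (by positivity)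
  convert h using 4
  ring

lemma sx_nonneg (k : ℕ) (y : ℝ) : 0 ≤ Sx k y := tsum_nonneg fun n => by positivity

lemma sx_deriv (k : ℕ) {y : ℝ} (hy : 0 < y) :
    HasDerivAt (Sx k) (-2 * π * y * Sx (k + 2) y) y := by
  have hu : Summable fun n : ℕ =>
      (2 * π * (2 * y)) * (((n : ℝ) + 1) ^ (k + 2) * Real.exp (-π * (n + 1) ^ 2 * (y / 2) ^ 2)) :=
    (sx_summable (k + 2) (half_pos hy)).mul_left _
  have hmem : y ∈ Ioo (y / 2) (2 * y) := ⟨by linarith, by linarith⟩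
  have key := hasDerivAt_tsum_of_isPreconnected
    (g := fun (n : ℕ) (z : ℝ) => ((n : ℝ) + 1) ^ k * Real.exp (-π * (n + 1) ^ 2 * z ^ 2))
    (g' := fun (n : ℕ) (z : ℝ) =>
      (-2 * π * z) * (((n : ℝ) + 1) ^ (k + 2) * Real.exp (-π * (n + 1) ^ 2 * z ^ 2)))
    hu (isOpen_Ioo (a := y / 2) (b := 2 * y)) isPreconnected_Ioo
    (fun n z _ => by
      have h1 : HasDerivAt (fun z : ℝ => -π * (n + 1) ^ 2 * z ^ 2)
          (-π * (n + 1) ^ 2 * (2 * z)) z := by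
        have h := (hasDerivAt_pow 2 z).const_mul (-π * ((n : ℝ) + 1) ^ 2)
        norm_num only [pow_one] at h
        convert h using 1 <;> ring
      refine (h1.exp.const_mul (((n : ℝ) + 1) ^ k)).congr_deriv ?_
      ring)
    (fun n z hz => by
      have hz0 : 0 < z := by linarith [hz.1]
      rw [norm_mul, Real.norm_eq_abs, Real.norm_eq_abs,
        abs_of_nonneg (a := _ * Real.exp _) (by positivity)]
      have : |-2 * π * z| = 2 * π * z := by
        rw [show -2 * π * z = -(2 * π * z) by ring, abs_neg, abs_of_pos (by positivity)]
      rw [this]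
      have h2 : (y / 2) ^ 2 ≤ z ^ 2 := by
        have := hz.1
        gcongr
      have h3 : -π * ((n : ℝ) + 1) ^ 2 * z ^ 2 ≤ -π * (n + 1) ^ 2 * (y / 2) ^ 2 := by
        have : 0 ≤ π * ((n : ℝ) + 1) ^ 2 := by positivity
        nlinarith
      have := hz.2.le
      gcongr)
    hmem (sx_summable k hy) hmem
  rw [tsum_mul_left] at key
  exact key

lemma rf_eq (y : ℝ) : Rf y = 2 * Sx 0 y := by simp [Rf, Sx]

lemma gf_deriv {y : ℝ} (hy : 0 < y) : HasDerivAt Gf (-4 * π * y * Sx 2 y) y := by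
  have h : Gf = fun y => 1 + 2 * Sx 0 y := by funext z; simp [Gf, rf_eq]
  rw [h]
  refine (((sx_deriv 0 hy).const_mul 2).const_add 1).congr_deriv ?_
  ring

lemma gf_deriv2 {y : ℝ} (hy : 0 < y) :
    HasDerivAt (deriv Gf) (-4 * π * Sx 2 y + 8 * π ^ 2 * y ^ 2 * Sx 4 y) y := by
  have h : deriv Gf =ᶠ[nhds y] fun y => -4 * π * y * Sx 2 y := by
    filter_upwards [Ioi_mem_nhds hy] with z hz using (gf_deriv hz).deriv
  refine HasDerivAt.congr_of_eventuallyEq ?_ h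
  refine (((hasDerivAt_id y).const_mul (-4 * π)).mul (sx_deriv 2 hy)).congr_deriv ?_
  simp
  ring

lemma hf_eq {y : ℝ} (hy : 0 < y) :
    Hf y = 8 * π ^ 2 * y ^ 4 * Sx 4 y - 12 * π * y ^ 2 * Sx 2 y := by
  rw [Hf, (gf_deriv2 hy).deriv, (gf_deriv hy).deriv]
  ring

lemma gf_int {y : ℝ} (hy : 0 < y) : Gf y = ∑' n : ℤ, Real.exp (-π * y ^ 2 * (n : ℝ) ^ 2) := by
  have hs := sx_summable 0 hy
  simp only [pow_zero, one_mul] at hs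
  have h1 : HasSum (fun n : ℕ => Real.exp (-π * y ^ 2 * (((n : ℤ) + 1 : ℤ) : ℝ) ^ 2)) (Sx 0 y) := by
    have := hs.hasSum
    convert this using 3
    · push_cast; ring
    · simp [Sx]
  have h2 : HasSum (fun n : ℕ => Real.exp (-π * y ^ 2 * ((-((n : ℤ) + 1) : ℤ) : ℝ) ^ 2)) (Sx 0 y) := by
    convert h1 using 4
    push_cast; ring
  have h3 := HasSum.of_add_one_of_neg_add_one (f := fun n : ℤ => Real.exp (-π * y ^ 2 * (n : ℝ) ^ 2)) h1 h2
  rw [h3.tsum_eq, Gf, rf_eq]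
  simp
  ring

lemma gf_inv {y : ℝ} (hy : 0 < y) : y * Gf y = Gf (y⁻¹) := by
  have h := Real.tsum_exp_neg_mul_int_sq (a := y ^ 2) (by positivity)
  rw [gf_int hy, gf_int (inv_pos.2 hy), h]
  have : (y ^ 2) ^ (1 / 2 : ℝ) = y := by
    rw [← Real.sqrt_eq_rpow, Real.sqrt_sq hy.le]
  rw [this]
  field_simp

lemma hf_inv {y : ℝ} (hy : 0 < y) : Hf y = y⁻¹ * Hf y⁻¹ := by
  have e1 : ∀ z : ℝ, 0 < z → Gf z + z * deriv Gf z = deriv Gf z⁻¹ * (-(z ^ 2)⁻¹) := by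
    intro z hz
    have hG : ∀ w : ℝ, 0 < w → HasDerivAt Gf (deriv Gf w) w :=
      fun w hw => (gf_deriv hw).differentiableAt.hasDerivAt
    have a := (hasDerivAt_id z).mul (hG z hz)
    have b := (hG z⁻¹ (inv_pos.2 hz)).comp z (hasDerivAt_inv hz.ne')
    have b' : HasDerivAt (id * Gf) (deriv Gf z⁻¹ * (-(z ^ 2)⁻¹)) z := by
      refine b.congr_of_eventuallyEq ?_
      filter_upwards [Ioi_mem_nhds hz] with w hw
      exact gf_inv hw
    simpa using a.unique b'
  have hy' := inv_pos.2 hy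
  have hG : HasDerivAt Gf (deriv Gf y) y := (gf_deriv hy).differentiableAt.hasDerivAt
  have hG2 : ∀ w : ℝ, 0 < w → HasDerivAt (deriv Gf) (deriv (deriv Gf) w) w :=
      fun w hw => (gf_deriv2 hw).differentiableAt.hasDerivAt
  have a := hG.add ((hasDerivAt_id y).mul (hG2 y hy))
  have c : HasDerivAt (fun z : ℝ => -(z ^ 2)⁻¹) (2 * (y ^ 3)⁻¹) y := by
    have := ((hasDerivAt_pow 2 y).inv (by positivity)).neg
    refine this.congr_deriv ?_
    simp
    field_simp
  have b := ((hG2 y⁻¹ hy').comp y (hasDerivAt_inv hy.ne')).mul c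
  have b' := b.congr_of_eventuallyEq (f₁ := Gf + id * deriv Gf) (by
      filter_upwards [Ioi_mem_nhds hy] with w hw
      exact e1 w hw)
  have e2 := a.unique b'
  simp only [id, Function.comp, one_mul] at e2
  have : Hf y = y * (deriv Gf y + (deriv Gf y + y * deriv (deriv Gf) y)) := by
    rw [Hf]; ring
  rw [this, e2, Hf]
  field_simp

lemma sx_decay (k : ℕ) : ∃ K : ℝ, 0 ≤ K ∧ ∀ y : ℝ, 1 ≤ y → Sx k y ≤ K * Real.exp (-y) := by
  have hs := sx_summable_c k (c := π / 2) (by positivity)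
  refine ⟨∑' n : ℕ, ((n : ℝ) + 1) ^ k * Real.exp (-(π / 2 * (n + 1) ^ 2)),
    tsum_nonneg fun n => by positivity, fun y hy => ?_⟩
  rw [← tsum_mul_right]
  refine (sx_summable k (by linarith)).tsum_le_tsum (fun n => ?_) (hs.mul_right _)
  rw [mul_assoc (((n : ℝ) + 1) ^ k), ← Real.exp_add]
  gcongr
  have hn : (0 : ℝ) ≤ n := Nat.cast_nonneg n
  have ha : 1 ≤ ((n : ℝ) + 1) ^ 2 := by nlinarith
  have hb : y ≤ y ^ 2 := by nlinarith
  generalize ((n : ℝ) + 1) ^ 2 = A at *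
  generalize y ^ 2 = B at *
  have h1 : (A + B) / 2 ≤ A * B := by nlinarith
  have h2 := Real.pi_gt_three
  have h3 : π * ((A + B) / 2) ≤ π * (A * B) := by gcongr
  nlinarith

lemma exp_le_pow (N : ℕ) {y : ℝ} (hy : 0 < y) : Real.exp (-y) ≤ N.factorial * (y ^ N)⁻¹ := by
  have h := Real.pow_div_factorial_le_exp y hy.le N
  rw [Real.exp_neg, ← inv_inv (N.factorial : ℝ), ← mul_inv]
  refine inv_anti₀ (by positivity) ?_
  rwa [div_eq_inv_mul] at h

lemma hf_nonneg1 {y : ℝ} (hy : 1 ≤ y) : 0 ≤ Hf y := by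
  have h0 : 0 < y := by linarith
  rw [hf_eq h0]
  have h1 : Sx 2 y ≤ Sx 4 y := by
    refine (sx_summable 2 h0).tsum_le_tsum (fun n => ?_) (sx_summable 4 h0)
    have hn : (0 : ℝ) ≤ n := Nat.cast_nonneg n
    gcongr <;> linarith
  have h2 := sx_nonneg 2 y
  have h3 : y ^ 2 ≤ y ^ 4 := pow_le_pow_right₀ hy (by norm_num)
  have h4 : y ^ 2 * Sx 2 y ≤ y ^ 4 * Sx 4 y := by gcongr
  have h5 : 0 ≤ y ^ 2 * Sx 2 y := by positivity
  have hp := Real.pi_gt_three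
  have : 12 * π * (y ^ 2 * Sx 2 y) ≤ 8 * π ^ 2 * (y ^ 4 * Sx 4 y) := by
    apply mul_le_mul _ h4 h5 (by positivity)
    nlinarith
  linarith

lemma hf_nonneg {y : ℝ} (hy : 0 < y) : 0 ≤ Hf y := by
  rcases le_total 1 y with h | h
  · exact hf_nonneg1 h
  · rw [hf_inv hy]
    exact mul_nonneg (inv_pos.2 hy).le (hf_nonneg1 ((one_le_inv₀ hy).2 h))

lemma hf_decay (N : ℕ) : ∃ M : ℝ, 0 ≤ M ∧ ∀ y : ℝ, 1 ≤ y → Hf y ≤ M * (y ^ N)⁻¹ := by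
  obtain ⟨K, hK, h⟩ := sx_decay 4
  refine ⟨8 * π ^ 2 * K * (N + 4).factorial, by positivity, fun y hy => ?_⟩
  have h0 : 0 < y := by linarith
  rw [hf_eq h0]
  have h2 := sx_nonneg 2 y
  have h3 : 0 ≤ 12 * π * y ^ 2 * Sx 2 y := by positivity
  have h4 : Sx 4 y ≤ K * ((N + 4).factorial * (y ^ (N + 4))⁻¹) :=
    (h y hy).trans (mul_le_mul_of_nonneg_left (exp_le_pow _ h0) hK)
  have h5 : 8 * π ^ 2 * y ^ 4 * Sx 4 y ≤
      8 * π ^ 2 * y ^ 4 * (K * ((N + 4).factorial * (y ^ (N + 4))⁻¹)) := by gcongr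
  have h6 : 8 * π ^ 2 * y ^ 4 * (K * ((N + 4).factorial * (y ^ (N + 4))⁻¹)) =
      8 * π ^ 2 * K * (N + 4).factorial * (y ^ N)⁻¹ := by
    rw [pow_add]; field_simp
  linarith

lemma hf_meas : Measurable Hf := by
  unfold Hf
  have h1 := measurable_deriv Gf
  have h2 := measurable_deriv (deriv Gf)
  fun_prop

lemma hf_int (a : ℝ) : IntegrableOn (fun y : ℝ => y ^ a * Hf y) (Ioi 0) := by
  have hm : Measurable (fun y : ℝ => y ^ a * Hf y) := by
    have := hf_meas
    fun_prop
  rw [← Ioc_union_Ioi_eq_Ioi (zero_le_one (α := ℝ))]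
  refine IntegrableOn.union ?_ ?_
  · obtain ⟨N, hN⟩ := exists_nat_ge (1 - a)
    obtain ⟨M, hM, h⟩ := hf_decay N
    refine Measure.integrableOn_of_bounded (M := M) (by simp) hm.aestronglyMeasurable ?_
    refine (ae_restrict_iff' measurableSet_Ioc).2 (Filter.Eventually.of_forall fun y hy => ?_)
    have h0 := hy.1
    rw [Real.norm_of_nonneg (mul_nonneg (by positivity) (hf_nonneg h0)), hf_inv h0]
    have h1 := h y⁻¹ ((one_le_inv₀ h0).2 hy.2)
    calc y ^ a * (y⁻¹ * Hf y⁻¹) ≤ y ^ a * (y⁻¹ * (M * ((y⁻¹) ^ N)⁻¹)) := by gcongr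
      _ = M * y ^ (a - 1 + N) := by
        rw [Real.rpow_add h0, Real.rpow_sub h0, Real.rpow_one, Real.rpow_natCast, inv_pow, inv_inv]
        field_simp
      _ ≤ M * 1 := by
        gcongr
        exact Real.rpow_le_one h0.le hy.2 (by linarith)
      _ = M := mul_one M
  · obtain ⟨N, hN⟩ := exists_nat_ge (a + 2)
    obtain ⟨M, hM, h⟩ := hf_decay N
    refine Integrable.mono' ((integrableOn_Ioi_rpow_of_lt (a := -2) (by norm_num)
      zero_lt_one).const_mul M) hm.aestronglyMeasurable ?_
    refine (ae_restrict_iff' measurableSet_Ioi).2 (Filter.Eventually.of_forall fun y hy => ?_)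
    have hy1 : 1 ≤ y := le_of_lt hy
    have h0 : 0 < y := by linarith
    rw [Real.norm_of_nonneg (mul_nonneg (by positivity) (hf_nonneg h0))]
    calc y ^ a * Hf y ≤ y ^ a * (M * (y ^ N)⁻¹) := by
          gcongr
          exact h y hy1
      _ = M * y ^ (a - N) := by
        rw [Real.rpow_sub h0, Real.rpow_natCast]
        field_simp
      _ ≤ M * y ^ (-2 : ℝ) := by
        gcongr
        linarith

lemma rf_nonneg (y : ℝ) : 0 ≤ Rf y := by
  rw [rf_eq]; have := sx_nonneg 0 y; positivity

lemma cn_bdd (m : ℕ) : BddAbove {x : ℝ | ∃ y : ℝ, 0 < y ∧ x = y ^ (m + 1) * Rf y} := by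
  obtain ⟨K, hK, h⟩ := sx_decay 0
  refine ⟨(1 + 2 * K) + 2 * K * (m + 1).factorial, ?_⟩
  rintro x ⟨y, hy, rfl⟩
  have hf : 0 ≤ 2 * K * (m + 1).factorial := by positivity
  rcases le_total 1 y with h1 | h1
  · have := (h y h1).trans (mul_le_mul_of_nonneg_left (exp_le_pow (m + 1) hy) hK)
    rw [rf_eq]
    calc y ^ (m + 1) * (2 * Sx 0 y)
        ≤ y ^ (m + 1) * (2 * (K * ((m + 1).factorial * (y ^ (m + 1))⁻¹))) := by gcongr
      _ = 2 * K * (m + 1).factorial := by field_simp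
      _ ≤ _ := by linarith
  · have h2 := h y⁻¹ ((one_le_inv₀ hy).2 h1)
    have h3 : Real.exp (-y⁻¹) ≤ 1 := Real.exp_le_one_iff.2 (by simpa using hy.le)
    have h4 : Gf y⁻¹ ≤ 1 + 2 * K := by
      rw [Gf, rf_eq]; nlinarith
    have h5 : y * Rf y ≤ 1 + 2 * K := by
      rw [← gf_inv hy, Gf] at h4; linarith
    have h6 : 0 ≤ y * Rf y := mul_nonneg hy.le (rf_nonneg y)
    have h7 : y ^ m ≤ 1 := pow_le_one₀ hy.le h1
    calc y ^ (m + 1) * Rf y = y ^ m * (y * Rf y) := by ring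
      _ ≤ 1 * (y * Rf y) := by gcongr
      _ ≤ _ := by linarith

lemma rf_le (m : ℕ) {y : ℝ} (hy : 0 < y) : Rf y ≤ Cn (m + 1) * (y ^ (m + 1))⁻¹ := by
  have : y ^ (m + 1) * Rf y ≤ Cn (m + 1) := le_csSup (cn_bdd m) ⟨y, hy, rfl⟩
  rw [← div_eq_mul_inv, le_div_iff₀ (by positivity)]
  linarith

theorem double_integral_bound (σ : ℝ) :
    (∫ y in Ioi (0 : ℝ), ∫ x in Ioi (1 : ℝ),
        Hf y * Rf (x * y) * x ^ (σ - 1) * y ^ (2 * σ - 1)) ≤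
      Cn (⌈|σ|⌉₊ + 1) * ∫ y in Ioi (0 : ℝ), y ^ (2 * (σ - 1) - ⌈|σ|⌉₊) * Hf y := by
  have hσ : σ ≤ (⌈|σ|⌉₊ : ℝ) := (le_abs_self σ).trans (Nat.le_ceil _)
  generalize ⌈|σ|⌉₊ = m at *
  have hC : 0 ≤ Cn (m + 1) := by
    have h1 := rf_le m (y := 1) one_pos
    have := rf_nonneg 1
    simp at h1
    linarith
  rw [← integral_const_mul]
  refine integral_mono_of_nonneg ?_ ((hf_int _).const_mul _) ?_
  · refine (ae_restrict_iff' measurableSet_Ioi).2 (Filter.Eventually.of_forall fun y hy => ?_)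
    have hy0 : 0 < y := hy
    refine setIntegral_nonneg measurableSet_Ioi fun x hx => ?_
    have hx0 : 0 < x := lt_trans one_pos hx
    have := hf_nonneg hy0
    have := rf_nonneg (x * y)
    positivity
  · refine (ae_restrict_iff' measurableSet_Ioi).2 (Filter.Eventually.of_forall fun y hy => ?_)
    have hy0 : 0 < y := hy
    have hH := hf_nonneg hy0
    have hlt : σ - 2 - m < -1 := by linarith
    have hint := (integrableOn_Ioi_rpow_of_lt hlt one_pos).const_mul
      (Cn (m + 1) * (y ^ (2 * (σ - 1) - m) * Hf y))
    have hle : (∫ x in Ioi (1 : ℝ), Hf y * Rf (x * y) * x ^ (σ - 1) * y ^ (2 * σ - 1)) ≤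
        ∫ x in Ioi (1 : ℝ), (Cn (m + 1) * (y ^ (2 * (σ - 1) - m) * Hf y)) * x ^ (σ - 2 - m) := by
      refine integral_mono_of_nonneg ?_ hint ?_
      · refine (ae_restrict_iff' measurableSet_Ioi).2 (Filter.Eventually.of_forall fun x hx => ?_)
        have hx0 : 0 < x := lt_trans one_pos hx
        have := rf_nonneg (x * y)
        simp only [Pi.zero_apply]
        positivity
      · refine (ae_restrict_iff' measurableSet_Ioi).2 (Filter.Eventually.of_forall fun x hx => ?_)
        have hx0 : 0 < x := lt_trans one_pos hx
        have h1 := rf_le m (mul_pos hx0 hy0)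
        calc Hf y * Rf (x * y) * x ^ (σ - 1) * y ^ (2 * σ - 1)
            ≤ Hf y * (Cn (m + 1) * ((x * y) ^ (m + 1))⁻¹) * x ^ (σ - 1) * y ^ (2 * σ - 1) := by
              gcongr
          _ = _ := by
            have ex : x ^ (σ - 2 - m) = x ^ (σ - 1) * (x ^ (m + 1))⁻¹ := by
              rw [← Real.rpow_natCast, ← Real.rpow_neg hx0.le, ← Real.rpow_add hx0]
              congr 1; push_cast; ring
            have ey : y ^ (2 * (σ - 1) - m) = y ^ (2 * σ - 1) * (y ^ (m + 1))⁻¹ := by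
              rw [← Real.rpow_natCast, ← Real.rpow_neg hy0.le, ← Real.rpow_add hy0]
              congr 1; push_cast; ring
            simp only []
            rw [ex, ey, mul_pow, mul_inv]
            ring
    refine hle.trans ?_
    rw [integral_const_mul, integral_Ioi_rpow_of_lt hlt one_pos, Real.one_rpow]
    have h1 : -1 / (σ - 2 - m + 1) ≤ 1 := by
      rw [div_le_iff_of_neg (by linarith)]
      linarith
    exact mul_le_of_le_one_right (by positivity) h1
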